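/- Let n ≥ 1 and 0 < s < 1. Let η : ℝⁿ×ℝ → ℝ be a smooth compactly supported function with −1 ≤ η ≤ 0, η ≡ −1 on the closed set {|x| ≤ 1} × [−1,1], and η ≡ 0 outside {|x| < 2} × (−4,4). Then there exist constants C₀ > 0 and T > 1 such that for all (x,t) ∈ ℝⁿ×ℝ with t ≤ −T and |t|/2 ≤ |x|² ≤ 2|t|, one has (∂_t−Δ)^s_{right} η(x,t) ≥ C₀ / (1 + |x|^{n+2+2s} + |t|^{n/2+1+s}). -/

import Mathlib

open MeasureTheory

/-- `ℝⁿ` as Euclidean space. -/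
abbrev En (n : ℕ) := EuclideanSpace ℝ (Fin n)

/-- The normalization constant `C_{n,s} = (4π)^{-n/2} / |Γ(-s)|`. -/
noncomputable def Cns (n : ℕ) (s : ℝ) : ℝ :=
  (4 * Real.pi) ^ (-(n : ℝ) / 2) / |Real.Gamma (-s)|

/-- The right fractional heat operator `(∂_t - Δ)^s_{right}` (real-valued version). -/
noncomputable def rightHeatR (n : ℕ) (s : ℝ) (φ : En n × ℝ → ℝ)
    (x : En n) (t : ℝ) : ℝ :=
  (Cns n s / 2) *
    ∫ τ in Set.Ioi (0 : ℝ), ∫ y : En n,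
      (2 * φ (x, t) - φ (x + y, t + τ) - φ (x - y, t + τ)) *
        (τ ^ (-((n : ℝ) / 2 + 1 + s)) * Real.exp (-‖y‖ ^ 2 / (4 * τ)))

/-- The normalization constant is positive for `0 < s < 1`. -/
theorem Cns_pos (n : ℕ) {s : ℝ} (hs0 : 0 < s) (hs1 : s < 1) : 0 < Cns n s := by
  have hG : Real.Gamma (-s) ≠ 0 := by
    refine Real.Gamma_ne_zero fun m hm => ?_
    have h : s = m := neg_injective hm
    rw [h] at hs0 hs1
    have h0 : 0 < m := by exact_mod_cast hs0
    have h1 : m < 1 := by exact_mod_cast hs1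
    omega
  unfold Cns
  have := Real.pi_pos
  positivity

/-- The integrand of the right fractional heat operator, as a function of `(τ, y)`. -/
noncomputable def rightHeatIntegrand (n : ℕ) (s : ℝ) (φ : En n × ℝ → ℝ) (x : En n) (t : ℝ)
    (p : ℝ × En n) : ℝ :=
  (2 * φ (x, t) - φ (x + p.2, t + p.1) - φ (x - p.2, t + p.1)) *
    (p.1 ^ (-((n : ℝ) / 2 + 1 + s)) * Real.exp (-‖p.2‖ ^ 2 / (4 * p.1)))

section Integrand

variable {n : ℕ} {s : ℝ} {η : En n × ℝ → ℝ}

theorem continuous_rightHeatIntegrand (hη : Continuous η)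
    (hη_outer : ∀ (x : En n) (t : ℝ), 2 ≤ ‖x‖ ∨ 4 ≤ |t| → η (x, t) = 0)
    (x : En n) {t : ℝ} (ht : t ≤ -8) :
    Continuous (rightHeatIntegrand n s η x t) := by
  have key : rightHeatIntegrand n s η x t = fun p : ℝ × En n =>
      (2 * η (x, t) - η (x + p.2, t + p.1) - η (x - p.2, t + p.1)) *
      ((max p.1 1) ^ (-((n : ℝ) / 2 + 1 + s)) *
        Real.exp (-‖p.2‖ ^ 2 / (4 * max p.1 1))) := by
    funext p
    unfold rightHeatIntegrand
    rcases le_total 1 p.1 with h | h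
    · rw [max_eq_left h]
    · have h4 : 4 ≤ |t + p.1| := le_abs.2 (Or.inr (by linarith))
      have h4' : 4 ≤ |t| := le_abs.2 (Or.inr (by linarith))
      rw [hη_outer _ _ (Or.inr h4), hη_outer _ _ (Or.inr h4), hη_outer _ _ (Or.inr h4')]
      simp
  have hpos : ∀ p : ℝ × En n, (0 : ℝ) < max p.1 1 := fun p =>
    lt_of_lt_of_le one_pos (le_max_right _ _)
  rw [key]
  refine Continuous.mul (by fun_prop) (Continuous.mul ?_ ?_)
  · exact Continuous.rpow_const (by fun_prop) fun p => Or.inl (hpos p).ne'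
  · refine Real.continuous_exp.comp (Continuous.div (by fun_prop) (by fun_prop) fun p => ?_)
    have := hpos p
    positivity

theorem rightHeatIntegrand_eq_zero
    (hη_outer : ∀ (x : En n) (t : ℝ), 2 ≤ ‖x‖ ∨ 4 ≤ |t| → η (x, t) = 0)
    {x : En n} {t : ℝ} (ht : t ≤ -8) {p : ℝ × En n}
    (hp : 4 ≤ |t + p.1| ∨ ‖x‖ + 2 ≤ ‖p.2‖) :
    rightHeatIntegrand n s η x t p = 0 := by
  have h0 : η (x, t) = 0 := hη_outer _ _ (Or.inr (le_abs.2 (Or.inr (by linarith))))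
  have h1 : η (x + p.2, t + p.1) = 0 := by
    refine hη_outer _ _ (hp.symm.imp_left fun h => ?_)
    have := norm_sub_le (x + p.2) x
    rw [add_sub_cancel_left] at this
    linarith
  have h2 : η (x - p.2, t + p.1) = 0 := by
    refine hη_outer _ _ (hp.symm.imp_left fun h => ?_)
    have := norm_sub_le x (x - p.2)
    rw [sub_sub_cancel] at this
    linarith
  simp [rightHeatIntegrand, h0, h1, h2]

theorem hasCompactSupport_rightHeatIntegrand
    (hη_outer : ∀ (x : En n) (t : ℝ), 2 ≤ ‖x‖ ∨ 4 ≤ |t| → η (x, t) = 0)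
    (x : En n) {t : ℝ} (ht : t ≤ -8) :
    HasCompactSupport (rightHeatIntegrand n s η x t) := by
  refine HasCompactSupport.intro
    ((isCompact_Icc (a := -t - 4) (b := -t + 4)).prod
      (isCompact_closedBall (0 : En n) (‖x‖ + 2))) fun p hp => ?_
  refine rightHeatIntegrand_eq_zero hη_outer ht ?_
  by_contra! h
  refine hp ⟨⟨?_, ?_⟩, ?_⟩
  · linarith [(abs_lt.1 h.1).1]
  · linarith [(abs_lt.1 h.1).2]
  · simpa using h.2.le

theorem rightHeatIntegrand_nonneg (hη_nonpos : ∀ p, η p ≤ 0) {x : En n} {t : ℝ}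
    (h0 : η (x, t) = 0) {p : ℝ × En n} (hp : 0 < p.1) :
    0 ≤ rightHeatIntegrand n s η x t p := by
  unfold rightHeatIntegrand
  refine mul_nonneg ?_ (by positivity)
  linarith [hη_nonpos (x + p.2, t + p.1), hη_nonpos (x - p.2, t + p.1)]

theorem le_rightHeatIntegrand (hs0 : 0 < s) (hη_nonpos : ∀ p, η p ≤ 0)
    (hη_inner : ∀ (x : En n) (t : ℝ), ‖x‖ ≤ 1 → |t| ≤ 1 → η (x, t) = -1)
    {x : En n} {t : ℝ} (ht : t ≤ -8) (h0 : η (x, t) = 0) (hx : ‖x‖ ^ 2 ≤ 2 * |t|)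
    {τ : ℝ} (hτ : τ ∈ Set.Icc (|t| - 1) (|t| + 1)) {y : En n}
    (hy : y ∈ Metric.closedBall (-x) 1) :
    (2 * |t|) ^ (-((n : ℝ) / 2 + 1 + s)) * Real.exp (-(5 / 2)) ≤
      rightHeatIntegrand n s η x t (τ, y) := by
  have hat : |t| = -t := abs_of_neg (by linarith)
  obtain ⟨hτ1, hτ2⟩ := hτ
  have hxy : ‖x + y‖ ≤ 1 := by
    rw [mem_closedBall_iff_norm, sub_neg_eq_add, add_comm] at hy
    exact hy
  have h1 : η (x + y, t + τ) = -1 :=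
    hη_inner _ _ hxy (abs_le.2 ⟨by linarith, by linarith⟩)
  have hτpos : 0 < τ := by linarith
  have hynorm : ‖y‖ ≤ ‖x‖ + 1 := by
    have := norm_sub_le (x + y) x
    rw [add_sub_cancel_left] at this
    linarith
  have hy2 : ‖y‖ ^ 2 ≤ 5 * |t| := by
    nlinarith [norm_nonneg y, norm_nonneg x, sq_nonneg (‖x‖ - 1)]
  have hpow : (2 * |t|) ^ (-((n : ℝ) / 2 + 1 + s)) ≤ τ ^ (-((n : ℝ) / 2 + 1 + s)) := by
    refine Real.rpow_le_rpow_of_nonpos hτpos (by linarith) ?_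
    have : 0 ≤ (n : ℝ) / 2 + 1 + s := by positivity
    linarith
  have hexp : Real.exp (-(5 / 2)) ≤ Real.exp (-‖y‖ ^ 2 / (4 * τ)) := by
    refine Real.exp_le_exp.2 ?_
    rw [le_div_iff₀ (by positivity)]
    linarith
  have hfac : 1 ≤ 2 * η (x, t) - η (x + y, t + τ) - η (x - y, t + τ) := by
    linarith [hη_nonpos (x - y, t + τ)]
  unfold rightHeatIntegrand
  calc _ ≤ τ ^ (-((n : ℝ) / 2 + 1 + s)) * Real.exp (-‖y‖ ^ 2 / (4 * τ)) := by gcongr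
    _ ≤ _ := le_mul_of_one_le_left (by positivity) hfac

end Integrand

/-- Lower bound for `(∂_t−Δ)^s_{right} η` along the region `|x|² ∼ |t|` with `t` very
negative, for the cutoff `η` of the counterexample. -/
theorem rightHeat_lower_bound_counterexample (n : ℕ) (hn : 1 ≤ n)
    (s : ℝ) (hs0 : 0 < s) (hs1 : s < 1)
    (η : En n × ℝ → ℝ) (hη_smooth : ContDiff ℝ (⊤ : ℕ∞) η) (hη_supp : HasCompactSupport η)
    (hη_range : ∀ p, -1 ≤ η p ∧ η p ≤ 0)
    (hη_inner : ∀ (x : En n) (t : ℝ), ‖x‖ ≤ 1 → |t| ≤ 1 → η (x, t) = -1)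
    (hη_outer : ∀ (x : En n) (t : ℝ), 2 ≤ ‖x‖ ∨ 4 ≤ |t| → η (x, t) = 0) :
    ∃ C₀ > (0 : ℝ), ∃ T > (1 : ℝ), ∀ (x : En n) (t : ℝ),
      t ≤ -T → |t| / 2 ≤ ‖x‖ ^ 2 → ‖x‖ ^ 2 ≤ 2 * |t| →
      C₀ / (1 + ‖x‖ ^ ((n : ℝ) + 2 + 2 * s) + |t| ^ ((n : ℝ) / 2 + 1 + s)) ≤
        rightHeatR n s η x t := by
  set q : ℝ := (n : ℝ) / 2 + 1 + s with hq
  set V : ℝ := volume.real (Metric.closedBall (0 : En n) 1) with hV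
  have hVpos : 0 < V :=
    ENNReal.toReal_pos (Metric.measure_closedBall_pos volume _ one_pos).ne'
      measure_closedBall_lt_top.ne
  have hC := Cns_pos n hs0 hs1
  refine ⟨Cns n s / 2 * (2 ^ (-q) * Real.exp (-(5 / 2)) * V * 2), by positivity, 8, by norm_num,
    fun x t ht _ hx2 => ?_⟩
  have hat : |t| = -t := abs_of_neg (by linarith)
  have htpos : 0 < |t| := by linarith
  have h0 : η (x, t) = 0 := hη_outer _ _ (Or.inr (by linarith))
  have hnonpos : ∀ p, η p ≤ 0 := fun p => (hη_range p).2
  have hcont : Continuous (rightHeatIntegrand n s η x t) :=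
    continuous_rightHeatIntegrand hη_smooth.continuous hη_outer x ht
  have hint : Integrable (rightHeatIntegrand n s η x t) (volume.prod volume) :=
    hcont.integrable_of_hasCompactSupport (hasCompactSupport_rightHeatIntegrand hη_outer x ht)
  have hslice : ∀ τ : ℝ, Integrable fun y : En n => rightHeatIntegrand n s η x t (τ, y) := by
    intro τ
    have hpair : Continuous fun y : En n => (τ, y) := by fun_prop
    refine (hcont.comp hpair).integrable_of_hasCompactSupport
      (HasCompactSupport.intro (isCompact_closedBall (0 : En n) (‖x‖ + 2)) fun y hy => ?_)
    refine rightHeatIntegrand_eq_zero hη_outer ht (Or.inr ?_)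
    simpa using (not_le.1 fun h => hy (mem_closedBall_zero_iff.2 h)).le
  have hinner : ∀ τ ∈ Set.Icc (|t| - 1) (|t| + 1),
      (2 * |t|) ^ (-q) * Real.exp (-(5 / 2)) * V ≤
        ∫ y : En n, rightHeatIntegrand n s η x t (τ, y) := by
    intro τ hτ
    have hVx : V = volume.real (Metric.closedBall (-x) 1) := by
      rw [hV, measureReal_def, measureReal_def, Measure.addHaar_closedBall_center volume (-x)]
    rw [hVx]
    refine (setIntegral_ge_of_const_le_real measurableSet_closedBall
      measure_closedBall_lt_top.ne
      (fun y hy => le_rightHeatIntegrand hs0 hnonpos hη_inner ht h0 hx2 hτ hy)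
      (hslice τ).integrableOn).trans ?_
    refine setIntegral_le_integral (hslice τ) (Filter.Eventually.of_forall fun y => ?_)
    exact rightHeatIntegrand_nonneg hnonpos h0 (by simp only; linarith [hτ.1])
  have houter : (2 * |t|) ^ (-q) * Real.exp (-(5 / 2)) * V * 2 ≤
      ∫ τ in Set.Ioi (0 : ℝ), ∫ y : En n, rightHeatIntegrand n s η x t (τ, y) := by
    have hG := hint.integral_prod_left
    have hvol : volume.real (Set.Icc (|t| - 1) (|t| + 1)) = 2 := by
      rw [Real.volume_real_Icc_of_le (by linarith)]
      ring
    have hIcc := setIntegral_ge_of_const_le_real measurableSet_Icc measure_Icc_lt_top.ne hinner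
      hG.integrableOn
    rw [hvol] at hIcc
    refine hIcc.trans ?_
    refine setIntegral_mono_set hG.integrableOn ?_
      (Filter.Eventually.of_forall fun τ hτ => ?_)
    · filter_upwards [ae_restrict_mem measurableSet_Ioi] with τ hτ
      exact integral_nonneg fun y => rightHeatIntegrand_nonneg hnonpos h0 hτ
    · exact lt_of_lt_of_le (by linarith) hτ.1
  calc _ ≤ Cns n s / 2 * (2 ^ (-q) * Real.exp (-(5 / 2)) * V * 2) / |t| ^ q := by
        gcongr
        have : 0 ≤ ‖x‖ ^ ((n : ℝ) + 2 + 2 * s) := by positivity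
        linarith
    _ = Cns n s / 2 * ((2 * |t|) ^ (-q) * Real.exp (-(5 / 2)) * V * 2) := by
        rw [Real.mul_rpow two_pos.le htpos.le, Real.rpow_neg htpos.le]
        ring
    _ ≤ rightHeatR n s η x t := mul_le_mul_of_nonneg_left houter (by positivity)
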